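/- Let F : ℝ^d → ℝ be continuously differentiable, with ‖∇F(x) − ∇F(y)‖ ≤ M‖x−y‖ for all x,y, ⟨x, ∇F(x)⟩ ≥ m‖x‖² − b for all x, and F(x) ≤ (M/2)‖x‖² + B‖x‖ + A for all x, where m, b, M, B, A > 0. Let J be a d×d real antisymmetric matrix, A_J := I + J, β > 0, and 0 < η ≤ 1/(M‖A_J‖²). For x ∈ ℝ^d let X₁ := x − ηA_J∇F(x) + √(2ηβ^{−1})ξ, where ξ is a standard Gaussian random vector in ℝ^d. Then (E[F(X₁)] − F(x))/η ≤ −(m²/(4(M+B)))·F(x) + m²(B/2+A)/(4(M+B)) + Mβ^{−1}d + mb/4. -/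

import Mathlib

open MeasureTheory ProbabilityTheory Matrix
open scoped RealInnerProductSpace ENNReal NNReal
open Gradient

noncomputable section

/-- Spectral norm (largest singular value) of a real matrix. -/
def specNorm {ι : Type*} [Fintype ι] [DecidableEq ι] (A : Matrix ι ι ℝ) : ℝ :=
  ‖Matrix.toEuclideanCLM (𝕜 := ℝ) A‖

/-- The standard Gaussian measure on `EuclideanSpace ℝ (Fin d)`. -/
def stdGaussianE (d : ℕ) : Measure (EuclideanSpace ℝ (Fin d)) :=
  (Measure.pi fun _ : Fin d => gaussianReal 0 1).map
    (MeasurableEquiv.toLp 2 (Fin d → ℝ))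

lemma nld_descent_up {d : ℕ} (F : EuclideanSpace ℝ (Fin d) → ℝ)
    (g : EuclideanSpace ℝ (Fin d) → EuclideanSpace ℝ (Fin d)) (M : ℝ)
    (hg : ∀ x, HasGradientAt F (g x) x)
    (hlip : ∀ x y, ‖g x - g y‖ ≤ M * ‖x - y‖) (x v : EuclideanSpace ℝ (Fin d)) :
    F (x + v) ≤ F x + ⟪g x, v⟫ + M / 2 * ‖v‖ ^ 2 := by
  have hd : ∀ t : ℝ, HasDerivAt (fun t : ℝ => F (x + t • v) - t * ⟪g x, v⟫ - M / 2 * ‖v‖ ^ 2 * t ^ 2)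
      (⟪g (x + t • v), v⟫ - ⟪g x, v⟫ - M / 2 * ‖v‖ ^ 2 * (2 * t)) t := by
    intro t
    have h1 : HasDerivAt (fun t : ℝ => x + t • v) v t := by
      simpa using ((hasDerivAt_id t).smul_const v).const_add x
    have h2 := (hg (x + t • v)).hasFDerivAt.comp_hasDerivAt t h1
    have h3 : HasDerivAt (fun t : ℝ => t * ⟪g x, v⟫) ⟪g x, v⟫ t := by
      simpa using (hasDerivAt_id t).mul_const ⟪g x, v⟫
    have h4 : HasDerivAt (fun t : ℝ => M / 2 * ‖v‖ ^ 2 * t ^ 2) (M / 2 * ‖v‖ ^ 2 * (2 * t)) t := by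
      simpa using ((hasDerivAt_pow 2 t).const_mul (M / 2 * ‖v‖ ^ 2))
    exact (h2.sub h3).sub h4
  have hanti : AntitoneOn
      (fun t : ℝ => F (x + t • v) - t * ⟪g x, v⟫ - M / 2 * ‖v‖ ^ 2 * t ^ 2) (Set.Icc 0 1) := by
    apply antitoneOn_of_deriv_nonpos (convex_Icc 0 1)
    · exact fun t _ => (hd t).continuousAt.continuousWithinAt
    · exact fun t _ => (hd t).differentiableAt.differentiableWithinAt
    · intro t ht
      rw [interior_Icc] at ht
      rw [(hd t).deriv, ← inner_sub_left]
      have h1 := real_inner_le_norm (g (x + t • v) - g x) v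
      have h2 := hlip (x + t • v) x
      rw [add_sub_cancel_left, norm_smul, Real.norm_of_nonneg ht.1.le] at h2
      have h3 := mul_le_mul_of_nonneg_right h2 (norm_nonneg v)
      nlinarith
  have := hanti (Set.left_mem_Icc.2 zero_le_one) (Set.right_mem_Icc.2 zero_le_one) zero_le_one
  simp at this
  linarith

lemma nld_gauss_eq (d : ℕ) : stdGaussianE d = stdGaussian (EuclideanSpace ℝ (Fin d)) := by
  rw [← map_pi_eq_stdGaussian]; rfl

lemma nld_gauss_sq (d : ℕ) :
    ∫ z, ‖z‖ ^ 2 ∂(stdGaussian (EuclideanSpace ℝ (Fin d))) = d := by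
  have hm : MemLp id 2 (stdGaussian (EuclideanSpace ℝ (Fin d))) := IsGaussian.memLp_two_id
  simp_rw [EuclideanSpace.real_norm_sq_eq]
  have key : ∀ i : Fin d, Integrable (fun z : EuclideanSpace ℝ (Fin d) => z i ^ 2)
      (stdGaussian (EuclideanSpace ℝ (Fin d))) ∧
      ∫ z, z i ^ 2 ∂(stdGaussian (EuclideanSpace ℝ (Fin d))) = 1 := by
    intro i
    let L : StrongDual ℝ (EuclideanSpace ℝ (Fin d)) := EuclideanSpace.proj i
    have hL : ∀ z, L z = z i := fun z => rfl
    have hmL : MemLp L 2 (stdGaussian (EuclideanSpace ℝ (Fin d))) :=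
      L.comp_memLp' hm
    have hn : ‖L‖ = 1 := by
      have : L = innerSL ℝ (EuclideanSpace.single i (1 : ℝ)) := by
        ext z; rw [innerSL_apply_apply, EuclideanSpace.inner_single_left, hL]; simp
      rw [this, innerSL_apply_norm]; simp
    refine ⟨hmL.integrable_sq, ?_⟩
    have hv := variance_dual_stdGaussian L
    rw [variance_of_integral_eq_zero hmL.aestronglyMeasurable.aemeasurable
      (integral_strongDual_stdGaussian L), hn] at hv
    simpa [hL] using hv
  rw [integral_finsetSum _ fun i _ => (key i).1]
  simp [fun i => (key i).2]

/-- One-step drift inequality for the non-reversible Langevin dynamics. -/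
theorem nld_one_step_drift
    {Ω : Type*} [MeasurableSpace Ω] (P : Measure Ω) [IsProbabilityMeasure P]
    {d : ℕ}
    (F : EuclideanSpace ℝ (Fin d) → ℝ) (hF : ContDiff ℝ 1 F)
    (m b M B A : ℝ)
    (hm : 0 < m) (hb : 0 < b) (hM : 0 < M) (hB : 0 < B) (hA : 0 < A)
    -- Lipschitz gradient
    (hlip : ∀ x y, ‖∇ F x - ∇ F y‖ ≤ M * ‖x - y‖)
    -- dissipativity
    (hdiss : ∀ x, ⟪x, ∇ F x⟫ ≥ m * ‖x‖ ^ 2 - b)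
    -- quadratic growth
    (hgrowth : ∀ x, F x ≤ M / 2 * ‖x‖ ^ 2 + B * ‖x‖ + A)
    -- J antisymmetric, A_J = I + J
    (J : Matrix (Fin d) (Fin d) ℝ) (hJ : Jᵀ = -J)
    (AJ : Matrix (Fin d) (Fin d) ℝ) (hAJ : AJ = 1 + J)
    (β η : ℝ) (hβ : 0 < β) (hη0 : 0 < η) (hη : η ≤ 1 / (M * specNorm AJ ^ 2))
    -- one step of the dynamics, driven by a standard Gaussian ξ
    (ξ : Ω → EuclideanSpace ℝ (Fin d)) (hξmeas : Measurable ξ)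
    (hξ : Measure.map ξ P = stdGaussianE d)
    (x : EuclideanSpace ℝ (Fin d))
    (X1 : Ω → EuclideanSpace ℝ (Fin d))
    (hX1 : ∀ ω, X1 ω = x - η • (Matrix.toEuclideanCLM (𝕜 := ℝ) AJ) (∇ F x) +
      Real.sqrt (2 * η * β⁻¹) • ξ ω) :
    ((∫ ω, F (X1 ω) ∂P) - F x) / η ≤
      -(m ^ 2 / (4 * (M + B))) * F x + m ^ 2 * (B / 2 + A) / (4 * (M + B)) +
        M * β⁻¹ * d + m * b / 4 := by
  have hgrad : ∀ y, HasGradientAt F (∇ F y) y := fun y =>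
    ((hF.differentiable one_ne_zero) y).hasGradientAt
  set g := ∇ F x with hgdef
  set T := Matrix.toEuclideanCLM (𝕜 := ℝ) AJ with hT
  set s := Real.sqrt (2 * η * β⁻¹) with hs
  have hs2 : s ^ 2 = 2 * η * β⁻¹ := Real.sq_sqrt (by positivity)
  -- antisymmetry
  have hin : ⟪g, T g⟫ = ‖g‖ ^ 2 := by
    have h0 : ⟪g, Matrix.toEuclideanCLM (𝕜 := ℝ) J g⟫ = 0 := by
      have h1 : ⟪g, Matrix.toEuclideanCLM (𝕜 := ℝ) J g⟫ =
          -⟪g, Matrix.toEuclideanCLM (𝕜 := ℝ) J g⟫ := by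
        have hstar : star J = -J := by
          rw [Matrix.star_eq_conjTranspose, Matrix.conjTranspose_eq_transpose_of_trivial, hJ]
        have h2 : ContinuousLinearMap.adjoint (Matrix.toEuclideanCLM (𝕜 := ℝ) J) =
            -Matrix.toEuclideanCLM (𝕜 := ℝ) J := by
          rw [← ContinuousLinearMap.star_eq_adjoint, ← map_star, hstar, map_neg]
        conv_lhs => rw [← ContinuousLinearMap.adjoint_inner_left, h2, real_inner_comm]
        simp
      linarith
    rw [hT, hAJ, map_add, map_one, _root_.add_apply, inner_add_right, h0]
    simp
  -- step size
  have hstep : η * M * ‖T g‖ ^ 2 ≤ ‖g‖ ^ 2 := by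
    have hpos : 0 < M * specNorm AJ ^ 2 := by
      have := hη0.trans_le hη
      exact one_div_pos.1 this
    have h1 : η * (M * specNorm AJ ^ 2) ≤ 1 := (le_div_iff₀ hpos).1 hη
    have h2 : ‖T g‖ ≤ specNorm AJ * ‖g‖ := T.le_opNorm g
    have h3 : ‖T g‖ ^ 2 ≤ (specNorm AJ * ‖g‖) ^ 2 := by gcongr
    calc η * M * ‖T g‖ ^ 2 ≤ η * M * (specNorm AJ * ‖g‖) ^ 2 := by gcongr
      _ = η * (M * specNorm AJ ^ 2) * ‖g‖ ^ 2 := by ring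
      _ ≤ 1 * ‖g‖ ^ 2 := by gcongr
      _ = _ := one_mul _
  -- Gaussian facts
  rw [nld_gauss_eq] at hξ
  have hmemid : MemLp id 2 (Measure.map ξ P) := by rw [hξ]; exact IsGaussian.memLp_two_id
  have hmem : MemLp ξ 2 P := (memLp_map_measure_iff hmemid.aestronglyMeasurable
    hξmeas.aemeasurable).1 hmemid
  have hi1 : Integrable ξ P := hmem.integrable (by norm_num)
  have hi2 : Integrable (fun ω => ‖ξ ω‖ ^ 2) P := hmem.integrable_norm_pow (by norm_num)
  have hE2 : ∫ ω, ‖ξ ω‖ ^ 2 ∂P = d := by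
    rw [← nld_gauss_sq d, ← hξ, integral_map hξmeas.aemeasurable (by fun_prop)]
  have hE1 : ∀ u, ∫ ω, ⟪u, ξ ω⟫ ∂P = 0 := by
    intro u
    have h := integral_strongDual_stdGaussian (innerSL ℝ u)
    rw [← hξ, integral_map hξmeas.aemeasurable (by fun_prop)] at h
    simpa using h
  have hi3 : ∀ u, Integrable (fun ω => ⟪u, ξ ω⟫) P := fun u => hi1.const_inner u
  -- pointwise expansions
  have hXe : ∀ ω, X1 ω = x + (s • ξ ω - η • T g) := by intro ω; rw [hX1]; abel
  have hinn : ∀ ω, ⟪g, s • ξ ω - η • T g⟫ = s * ⟪g, ξ ω⟫ - η * ‖g‖ ^ 2 := by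
    intro ω
    rw [inner_sub_right, inner_smul_right, inner_smul_right, hin]
  have hnsq : ∀ ω, ‖s • ξ ω - η • T g‖ ^ 2 =
      s ^ 2 * ‖ξ ω‖ ^ 2 - 2 * (s * η) * ⟪T g, ξ ω⟫ + η ^ 2 * ‖T g‖ ^ 2 := by
    intro ω
    rw [norm_sub_sq_real, norm_smul, norm_smul, inner_smul_left, inner_smul_right,
      real_inner_comm, mul_pow, mul_pow, Real.norm_eq_abs, Real.norm_eq_abs, sq_abs, sq_abs]
    simp
    ring
  have hup : ∀ ω, F (X1 ω) ≤ F x + (s * ⟪g, ξ ω⟫ - η * ‖g‖ ^ 2) + M / 2 *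
      (s ^ 2 * ‖ξ ω‖ ^ 2 - 2 * (s * η) * ⟪T g, ξ ω⟫ + η ^ 2 * ‖T g‖ ^ 2) := by
    intro ω
    rw [hXe, ← hinn, ← hnsq]
    exact nld_descent_up F _ M hgrad hlip x _
  have hlo : ∀ ω, F x + (s * ⟪g, ξ ω⟫ - η * ‖g‖ ^ 2) - M / 2 *
      (s ^ 2 * ‖ξ ω‖ ^ 2 - 2 * (s * η) * ⟪T g, ξ ω⟫ + η ^ 2 * ‖T g‖ ^ 2) ≤ F (X1 ω) := by
    intro ω
    rw [hXe, ← hinn, ← hnsq]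
    have := nld_descent_up (fun y => - F y) (fun y => -∇ F y) M
      (fun y => by
        have := (hgrad y).hasFDerivAt.neg
        rw [hasGradientAt_iff_hasFDerivAt, map_neg]
        exact this)
      (fun y z => by rw [← neg_sub', norm_neg]; exact hlip y z) x (s • ξ ω - η • T g)
    simp only [inner_neg_left] at this
    linarith
  have hiQ : Integrable (fun ω => M / 2 *
      (s ^ 2 * ‖ξ ω‖ ^ 2 - 2 * (s * η) * ⟪T g, ξ ω⟫ + η ^ 2 * ‖T g‖ ^ 2)) P :=
    (((hi2.const_mul _).sub ((hi3 _).const_mul _)).add (integrable_const _)).const_mul _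
  have hiL : Integrable (fun ω => F x + (s * ⟪g, ξ ω⟫ - η * ‖g‖ ^ 2)) P :=
    (integrable_const _).add (((hi3 _).const_mul _).sub (integrable_const _))
  have hXm : Measurable X1 := by
    have : X1 = fun ω => x + (s • ξ ω - η • T g) := funext hXe
    rw [this]; fun_prop
  have hiF : Integrable (fun ω => F (X1 ω)) P :=
    integrable_of_le_of_le (hF.continuous.measurable.comp hXm).aestronglyMeasurable
      (Filter.Eventually.of_forall hlo) (Filter.Eventually.of_forall hup)
      (hiL.sub hiQ) (hiL.add hiQ)
  have hint : ∫ ω, F (X1 ω) ∂P ≤ F x - η * ‖g‖ ^ 2 + M / 2 * (s ^ 2 * d + η ^ 2 * ‖T g‖ ^ 2) := by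
    refine (integral_mono hiF (hiL.add hiQ) hup).trans_eq ?_
    have e1 : ∫ ω, (F x + (s * ⟪g, ξ ω⟫ - η * ‖g‖ ^ 2)) ∂P = F x - η * ‖g‖ ^ 2 := by
      have i1 : Integrable (fun ω => s * ⟪g, ξ ω⟫ - η * ‖g‖ ^ 2) P :=
        ((hi3 _).const_mul _).sub (integrable_const _)
      rw [integral_add (integrable_const _) i1,
        integral_sub ((hi3 _).const_mul _) (integrable_const _), integral_const_mul, hE1]
      simp
      ring
    have e2 : ∫ ω, M / 2 *
      (s ^ 2 * ‖ξ ω‖ ^ 2 - 2 * (s * η) * ⟪T g, ξ ω⟫ + η ^ 2 * ‖T g‖ ^ 2) ∂P =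
        M / 2 * (s ^ 2 * d + η ^ 2 * ‖T g‖ ^ 2) := by
      have i1 : Integrable (fun ω => s ^ 2 * ‖ξ ω‖ ^ 2 - 2 * (s * η) * ⟪T g, ξ ω⟫) P :=
        (hi2.const_mul _).sub ((hi3 _).const_mul _)
      rw [integral_const_mul, integral_add i1 (integrable_const _), integral_sub (hi2.const_mul _) ((hi3 _).const_mul _),
        integral_const_mul, integral_const_mul, hE1, hE2]
      simp
    rw [← e1, ← e2]
    exact integral_add hiL hiQ
  have hdrift : ((∫ ω, F (X1 ω) ∂P) - F x) / η ≤ -(1 / 2) * ‖g‖ ^ 2 + M * β⁻¹ * d := by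
    rw [div_le_iff₀ hη0]
    rw [hs2] at hint
    have := mul_le_mul_of_nonneg_left hstep hη0.le
    nlinarith
  -- deterministic part
  have hd1 : m ^ 2 * ‖x‖ ^ 2 / 8 ≤ ‖g‖ ^ 2 / 8 + m * b / 4 := by
    have h1 := hdiss x
    have h2 := real_inner_le_norm x (∇ F x)
    have h3 : m * ‖x‖ ^ 2 - b ≤ ‖x‖ * ‖g‖ := by linarith
    have h4 := mul_le_mul_of_nonneg_left h3 hm.le
    nlinarith [sq_nonneg (m * ‖x‖ - ‖g‖)]
  have hd2 : m ^ 2 / (4 * (M + B)) * (F x - (B / 2 + A)) ≤ m ^ 2 * ‖x‖ ^ 2 / 8 := by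
    have h1 : F x - (B / 2 + A) ≤ (M + B) / 2 * ‖x‖ ^ 2 := by
      nlinarith [hgrowth x, sq_nonneg (‖x‖ - 1)]
    calc _ ≤ m ^ 2 / (4 * (M + B)) * ((M + B) / 2 * ‖x‖ ^ 2) := by gcongr
      _ = _ := by field_simp; ring
  have hd3 : m ^ 2 * (B / 2 + A) / (4 * (M + B)) = m ^ 2 / (4 * (M + B)) * (B / 2 + A) := by ring
  rw [hd3]
  nlinarith [sq_nonneg ‖g‖]

end
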